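/- Every minimum consistent subset M of the reduction tree T contains exactly one vertex from every literal path. Moreover, in each variable gadget, one of the two literal paths has one of its first three vertices in M, and the other literal path has its fifth vertex in M. -/

import Mathlib

/-- `C` is a consistent subset of the vertex-coloured graph `(G, col)`:
for every vertex `v ∉ C` there is `u ∈ C` of the same colour whose hop-distance
to `v` is minimum among all vertices of `C`. -/
def IsConsistent {V κ : Type*} (G : SimpleGraph V) (col : V → κ) (C : Set V) : Prop :=
  ∀ v ∉ C, ∃ u ∈ C, col u = col v ∧ ∀ w ∈ C, G.dist v u ≤ G.dist v w

/-- `M` is a minimum consistent subset: a consistent subset of minimum cardinality. -/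
def IsMinConsistent {V κ : Type*} (G : SimpleGraph V) (col : V → κ) (M : Set V) : Prop :=
  IsConsistent G col M ∧ ∀ C : Set V, IsConsistent G col C → M.ncard ≤ C.ncard

/-- A literal: a variable index together with a sign (`true` = positive). -/
abbrev Lit (n : ℕ) := Fin n × Bool

/-- The literal `l` is true under the assignment `a`. -/
def litTrue {n : ℕ} (a : Fin n → Bool) (l : Lit n) : Bool := a l.1 == l.2

/-- The number of clauses of the 2-CNF formula `θ` satisfied by the assignment `a`
(a clause is satisfied if at least one of its two literals is true). -/
def satCount {n m : ℕ} (θ : Fin m → Lit n × Lit n) (a : Fin n → Bool) : ℕ :=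
  (Finset.univ.filter fun j : Fin m =>
    (litTrue a (θ j).1 || litTrue a (θ j).2) = true).card

/-- The vertices of the reduction tree `T` for a 2-CNF formula with `n` variables
and `m` clauses:
* `lit i s q`  : the `(q+1)`-st vertex of the positive (`s = true`) or negative
  (`s = false`) literal path of the variable gadget of `x i`;
* `varp i j q` : the `(q+1)`-st vertex of the `(j+1)`-st variable path of `x i`;
* `stab i j s` : the left (`s = false`) or right (`s = true`) stabilizer of the
  `(j+1)`-st stabilizer pair of `x i`;
* `cl j q`     : the `(q+1)`-st vertex of the clause path of clause `j`;
* `occ j s q`  : the `(q+1)`-st vertex of the left (`s = false`) or right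
  (`s = true`) occurrence path of clause `j`;
* `chain none` : the central chain vertex `p₀`; `chain (some (j, r))` : the
  `(r+1)`-st of the three chain vertices joining `p₀` to clause `j`;
* `ext c q`    : the `(q+1)`-st of the seven extra vertices of the chain path
  attached to the chain vertex `chain c`. -/
inductive TVert (n m : ℕ) : Type where
  | lit   : Fin n → Bool → Fin 5 → TVert n m
  | varp  : Fin n → Fin 5 → Fin 6 → TVert n m
  | stab  : Fin n → Fin (m * n) → Bool → TVert n m
  | cl    : Fin m → Fin 17 → TVert n m
  | occ   : Fin m → Bool → Fin 2 → TVert n m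
  | chain : Option (Fin m × Fin 3) → TVert n m
  | ext   : Option (Fin m × Fin 3) → Fin 7 → TVert n m
deriving DecidableEq

/-- The base (one-directional) adjacency relation of the reduction tree. -/
inductive TAdj (n m : ℕ) : TVert n m → TVert n m → Prop where
  | litPath (i : Fin n) (s : Bool) (a b : Fin 5) (h : (a : ℕ) + 1 = b) :
      TAdj n m (.lit i s a) (.lit i s b)
  | varPath (i : Fin n) (j : Fin 5) (a b : Fin 6) (h : (a : ℕ) + 1 = b) :
      TAdj n m (.varp i j a) (.varp i j b)
  | varSpine (i : Fin n) (j j' : Fin 5) (h : (j : ℕ) + 1 = j') :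
      TAdj n m (.varp i j 0) (.varp i j' 0)
  | stabLeft (i : Fin n) (j : Fin (m * n)) :
      TAdj n m (.stab i j false) (.varp i 0 0)
  | stabRight (i : Fin n) (j : Fin (m * n)) :
      TAdj n m (.stab i j true) (.varp i 4 0)
  | litPos (i : Fin n) : TAdj n m (.lit i true 0) (.varp i 0 0)
  | litNeg (i : Fin n) : TAdj n m (.lit i false 0) (.varp i 4 0)
  | clPath (j : Fin m) (a b : Fin 17) (h : (a : ℕ) + 1 = b) :
      TAdj n m (.cl j a) (.cl j b)
  | occPath (j : Fin m) (s : Bool) : TAdj n m (.occ j s 0) (.occ j s 1)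
  | occLeft (j : Fin m) : TAdj n m (.occ j false 0) (.cl j 1)
  | occRight (j : Fin m) : TAdj n m (.occ j true 0) (.cl j 15)
  | centerVar (i : Fin n) : TAdj n m (.chain none) (.varp i 2 0)
  | chainStart (j : Fin m) : TAdj n m (.chain none) (.chain (some (j, 0)))
  | chainStep (j : Fin m) (r r' : Fin 3) (h : (r : ℕ) + 1 = r') :
      TAdj n m (.chain (some (j, r))) (.chain (some (j, r')))
  | chainClause (j : Fin m) : TAdj n m (.chain (some (j, 2))) (.cl j 8)
  | extAttach (c : Option (Fin m × Fin 3)) : TAdj n m (.chain c) (.ext c 0)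
  | extPath (c : Option (Fin m × Fin 3)) (a b : Fin 7) (h : (a : ℕ) + 1 = b) :
      TAdj n m (.ext c a) (.ext c b)

/-- The reduction tree `T`, as a simple graph. -/
def redTree (n m : ℕ) : SimpleGraph (TVert n m) := SimpleGraph.fromRel (TAdj n m)

/-- The colours of the reduction tree: one for each literal path (shared by the
corresponding occurrence paths), one for each variable path, one for each
stabilizer pair, one for each clause path, and one for each chain path. -/
inductive TCol (n m : ℕ) : Type where
  | litC  : Fin n → Bool → TCol n m
  | varC  : Fin n → Fin 5 → TCol n m
  | stabC : Fin n → Fin (m * n) → TCol n m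
  | clC   : Fin m → TCol n m
  | chC   : Option (Fin m × Fin 3) → TCol n m
deriving DecidableEq

/-- The colouring of the reduction tree determined by the 2-CNF formula `θ`:
each occurrence path gets the colour of the literal path of its literal, and
every other path (and each stabilizer pair) gets its own distinct colour; each
chain vertex shares the colour of its attached chain path. -/
def tcol {n m : ℕ} (θ : Fin m → Lit n × Lit n) : TVert n m → TCol n m
  | .lit i s _  => .litC i s
  | .varp i j _ => .varC i j
  | .stab i j _ => .stabC i j
  | .cl j _     => .clC j
  | .occ j s _  => if s then .litC (θ j).2.1 (θ j).2.2 else .litC (θ j).1.1 (θ j).1.2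
  | .chain c    => .chC c
  | .ext c _    => .chC c

section Lipschitz

variable {V : Type*} {G : SimpleGraph V}

lemma SimpleGraph.exists_walk_of_consecutive_adj {k : ℕ} (p : Fin k → V)
    (h : ∀ a b : Fin k, (a : ℕ) + 1 = b → G.Adj (p a) (p b)) (a b : Fin k) (hab : a ≤ b) :
    ∃ w : G.Walk (p a) (p b), w.length = (b : ℕ) - a := by
  obtain ⟨b, hb⟩ := b
  induction b with
  | zero =>
    obtain rfl : a = ⟨0, hb⟩ := le_antisymm hab (Fin.mk_le_of_le_val (Nat.zero_le _))
    exact ⟨.nil, by simp⟩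
  | succ b ih =>
    rcases hab.eq_or_lt with rfl | hlt
    · exact ⟨.nil, by simp⟩
    · have hab' : (a : ℕ) ≤ b := Nat.lt_succ_iff.mp hlt
      obtain ⟨w, hw⟩ := ih (Nat.lt_of_succ_lt hb) hab'
      refine ⟨w.concat (h _ _ rfl), ?_⟩
      simp only [SimpleGraph.Walk.length_concat, hw]
      omega

lemma SimpleGraph.reachable_of_consecutive_adj {k : ℕ} (p : Fin k → V)
    (h : ∀ a b : Fin k, (a : ℕ) + 1 = b → G.Adj (p a) (p b)) (a b : Fin k) :
    G.Reachable (p a) (p b) := by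
  rcases le_total a b with hab | hab
  · exact ⟨(G.exists_walk_of_consecutive_adj p h a b hab).choose⟩
  · exact ⟨(G.exists_walk_of_consecutive_adj p h b a hab).choose.reverse⟩

lemma SimpleGraph.dist_le_of_consecutive_adj {k : ℕ} (p : Fin k → V)
    (h : ∀ a b : Fin k, (a : ℕ) + 1 = b → G.Adj (p a) (p b)) (a b : Fin k) :
    G.dist (p a) (p b) ≤ ((a : ℕ) - b) + ((b : ℕ) - a) := by
  rcases le_total a b with hab | hab
  · obtain ⟨w, hw⟩ := G.exists_walk_of_consecutive_adj p h a b hab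
    exact (SimpleGraph.dist_le w).trans (by omega)
  · obtain ⟨w, hw⟩ := G.exists_walk_of_consecutive_adj p h b a hab
    rw [SimpleGraph.dist_comm]
    exact (SimpleGraph.dist_le w).trans (by omega)

lemma SimpleGraph.Connected.le_add_dist_of_adj (hG : G.Connected) {f : V → ℕ}
    (hf : ∀ a b, G.Adj a b → f a ≤ f b + 1) (a b : V) : f a ≤ f b + G.dist a b := by
  obtain ⟨w, hw⟩ := hG.exists_walk_length_eq_dist a b
  rw [← hw]
  clear hw
  induction w with
  | nil => simp
  | cons hadj _ ih =>
    have := hf _ _ hadj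
    simp only [SimpleGraph.Walk.length_cons]
    omega

end Lipschitz

section Consistent

variable {V κ : Type*} {G : SimpleGraph V} {col : V → κ}

lemma IsConsistent.exists_mem_color_eq {C : Set V} (hC : IsConsistent G col C) (v : V) :
    ∃ u ∈ C, col u = col v := by
  by_cases hv : v ∈ C
  · exact ⟨v, hv, rfl⟩
  · obtain ⟨u, hu, hcol, -⟩ := hC v hv
    exact ⟨u, hu, hcol⟩

lemma IsMinConsistent.eq_of_subset [Finite V] {M C : Set V} (hM : IsMinConsistent G col M)
    (hC : IsConsistent G col C) (hCM : C ⊆ M) : C = M :=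
  Set.eq_of_subset_of_ncard_le hCM (hM.2 C hC) (Set.toFinite M)

end Consistent

namespace RedTree

variable {n m : ℕ}

instance : Finite (TVert n m) := by
  let g : (Fin n × Bool × Fin 5) ⊕ (Fin n × Fin 5 × Fin 6) ⊕ (Fin n × Fin (m * n) × Bool) ⊕
      (Fin m × Fin 17) ⊕ (Fin m × Bool × Fin 2) ⊕ Option (Fin m × Fin 3) ⊕
      (Option (Fin m × Fin 3) × Fin 7) → TVert n m :=
    Sum.elim (fun x => .lit x.1 x.2.1 x.2.2) <| Sum.elim (fun x => .varp x.1 x.2.1 x.2.2) <|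
    Sum.elim (fun x => .stab x.1 x.2.1 x.2.2) <| Sum.elim (fun x => .cl x.1 x.2) <|
    Sum.elim (fun x => .occ x.1 x.2.1 x.2.2) <| Sum.elim .chain fun x => .ext x.1 x.2
  refine Finite.of_surjective g ?_
  rintro (⟨i, s, q⟩ | ⟨i, j, q⟩ | ⟨i, j, s⟩ | ⟨j, q⟩ | ⟨j, s, q⟩ | c | ⟨c, q⟩)
  · exact ⟨.inl (i, s, q), rfl⟩
  · exact ⟨.inr (.inl (i, j, q)), rfl⟩
  · exact ⟨.inr (.inr (.inl (i, j, s))), rfl⟩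
  · exact ⟨.inr (.inr (.inr (.inl (j, q)))), rfl⟩
  · exact ⟨.inr (.inr (.inr (.inr (.inl (j, s, q))))), rfl⟩
  · exact ⟨.inr (.inr (.inr (.inr (.inr (.inl c))))), rfl⟩
  · exact ⟨.inr (.inr (.inr (.inr (.inr (.inr (c, q)))))), rfl⟩

lemma adj_of_tAdj {a b : TVert n m} (h : TAdj n m a b) : (redTree n m).Adj a b := by
  refine (SimpleGraph.fromRel_adj _ _ _).mpr ⟨?_, .inl h⟩
  rintro rfl
  cases h <;> simp_all

lemma adj_lipschitz {f : TVert n m → ℕ}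
    (hf : ∀ a b, TAdj n m a b → f a ≤ f b + 1 ∧ f b ≤ f a + 1) (a b : TVert n m)
    (h : (redTree n m).Adj a b) : f a ≤ f b + 1 := by
  rcases ((SimpleGraph.fromRel_adj _ _ _).mp h).2 with h | h
  · exact (hf _ _ h).1
  · exact (hf _ _ h).2

/-- The spine vertex to which the stabilizers of side `s` are attached. -/
abbrev hub (i : Fin n) (s : Bool) : TVert n m := .varp i (if s then 4 else 0) 0

lemma adj_stab_hub (i : Fin n) (j : Fin (m * n)) (s : Bool) :
    (redTree n m).Adj (.stab i j s) (hub i s) := by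
  cases s
  · exact adj_of_tAdj (.stabLeft i j)
  · exact adj_of_tAdj (.stabRight i j)

lemma adj_lit_hub (i : Fin n) (s : Bool) :
    (redTree n m).Adj (.lit i s 0) (hub i !s) := by
  cases s
  · exact adj_of_tAdj (.litNeg i)
  · exact adj_of_tAdj (.litPos i)

lemma reachable_center (v : TVert n m) : (redTree n m).Reachable v (.chain none) := by
  have hspine (i : Fin n) (j : Fin 5) :
      (redTree n m).Reachable (.varp i j 0) (.chain none) :=
    ((redTree n m).reachable_of_consecutive_adj (fun j => TVert.varp i j 0)
      (fun a b h => adj_of_tAdj (.varSpine i a b h)) j 2).trans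
        (adj_of_tAdj (.centerVar i)).reachable.symm
  have hchain (c : Option (Fin m × Fin 3)) :
      (redTree n m).Reachable (.chain c) (.chain none) := by
    rcases c with _ | ⟨j, r⟩
    · rfl
    · exact ((redTree n m).reachable_of_consecutive_adj (fun r => TVert.chain (some (j, r)))
        (fun a b h => adj_of_tAdj (.chainStep j a b h)) r 0).trans
          (adj_of_tAdj (.chainStart j)).reachable.symm
  have hcl (j : Fin m) (q : Fin 17) : (redTree n m).Reachable (.cl j q) (.chain none) :=
    (((redTree n m).reachable_of_consecutive_adj (fun q => TVert.cl j q)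
      (fun a b h => adj_of_tAdj (.clPath j a b h)) q 8).trans
        (adj_of_tAdj (.chainClause j)).reachable.symm).trans (hchain _)
  have hocc (j : Fin m) (s : Bool) : (redTree n m).Reachable (.occ j s 0) (.chain none) := by
    cases s
    · exact (adj_of_tAdj (.occLeft j)).reachable.trans (hcl j 1)
    · exact (adj_of_tAdj (.occRight j)).reachable.trans (hcl j 15)
  rcases v with ⟨i, s, q⟩ | ⟨i, j, q⟩ | ⟨i, j, s⟩ | ⟨j, q⟩ | ⟨j, s, q⟩ | c | ⟨c, q⟩
  · exact (((redTree n m).reachable_of_consecutive_adj (fun q => TVert.lit i s q)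
      (fun a b h => adj_of_tAdj (.litPath i s a b h)) q 0).trans
        (adj_lit_hub i s).reachable).trans (hspine i _)
  · exact ((redTree n m).reachable_of_consecutive_adj (fun q => TVert.varp i j q)
      (fun a b h => adj_of_tAdj (.varPath i j a b h)) q 0).trans (hspine i j)
  · exact (adj_stab_hub i j s).reachable.trans (hspine i _)
  · exact hcl j q
  · fin_cases q
    · exact hocc j s
    · exact (adj_of_tAdj (.occPath j s)).reachable.symm.trans (hocc j s)
  · exact hchain c
  · exact (((redTree n m).reachable_of_consecutive_adj (fun q => TVert.ext c q)
      (fun a b h => adj_of_tAdj (.extPath c a b h)) q 0).trans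
        (adj_of_tAdj (.extAttach c)).reachable.symm).trans (hchain c)

lemma connected : (redTree n m).Connected where
  preconnected u v := (reachable_center u).trans (reachable_center v).symm
  nonempty := ⟨.chain none⟩

lemma le_add_dist {f : TVert n m → ℕ}
    (hf : ∀ a b, TAdj n m a b → f a ≤ f b + 1 ∧ f b ≤ f a + 1) (a b : TVert n m) :
    f a ≤ f b + (redTree n m).dist a b :=
  connected.le_add_dist_of_adj (adj_lipschitz hf) a b

lemma dist_lit_lit_le (i : Fin n) (s : Bool) (a b : Fin 5) :
    (redTree n m).dist (.lit i s a) (.lit i s b) ≤ ((a : ℕ) - b) + ((b : ℕ) - a) :=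
  (redTree n m).dist_le_of_consecutive_adj (fun q => TVert.lit i s q)
    (fun a b h => adj_of_tAdj (.litPath i s a b h)) a b

lemma dist_hub_hub_le (i : Fin n) (s t : Bool) :
    (redTree n m).dist (hub i s) (hub i t) ≤ 4 := by
  refine ((redTree n m).dist_le_of_consecutive_adj (fun j => TVert.varp i j 0)
    (fun a b h => adj_of_tAdj (.varSpine i a b h)) _ _).trans ?_
  cases s <;> cases t <;> simp

lemma dist_stab_hub_le (i : Fin n) (j : Fin (m * n)) (s : Bool) :
    (redTree n m).dist (.stab i j s) (hub i s) ≤ 1 :=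
  (SimpleGraph.dist_eq_one_iff_adj.mpr (adj_stab_hub i j s)).le

lemma dist_lit_hub_le (i : Fin n) (s : Bool) (q : Fin 5) :
    (redTree n m).dist (.lit i s q) (hub i !s) ≤ q + 1 := by
  have h₁ := connected.dist_triangle (u := (.lit i s q : TVert n m)) (v := .lit i s 0)
    (w := hub i !s)
  have h₂ := dist_lit_lit_le (m := m) i s q 0
  have h₃ := (SimpleGraph.dist_eq_one_iff_adj.mpr (adj_lit_hub (m := m) i s)).le
  simp only [Fin.val_zero] at h₂
  omega

lemma dist_stab_stab_le (i : Fin n) (j j' : Fin (m * n)) (s t : Bool) :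
    (redTree n m).dist (.stab i j s) (.stab i j' t) ≤ 6 := by
  have h₁ := connected.dist_triangle (u := (.stab i j s : TVert n m)) (v := hub i s)
    (w := .stab i j' t)
  have h₂ := connected.dist_triangle (u := (hub i s : TVert n m)) (v := hub i t)
    (w := .stab i j' t)
  have h₃ := dist_stab_hub_le i j s
  have h₄ := dist_stab_hub_le i j' t
  have h₅ := dist_hub_hub_le (m := m) i s t
  rw [SimpleGraph.dist_comm] at h₄
  omega

lemma dist_lit_stab_le (i : Fin n) (j : Fin (m * n)) (s : Bool) (q : Fin 5) :
    (redTree n m).dist (.lit i s q) (.stab i j !s) ≤ q + 2 := by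
  have h₁ := connected.dist_triangle (u := (.lit i s q : TVert n m)) (v := hub i !s)
    (w := .stab i j !s)
  have h₂ := dist_lit_hub_le (m := m) i s q
  have h₃ := dist_stab_hub_le i j !s
  rw [SimpleGraph.dist_comm] at h₃
  omega

lemma dist_lit_stab_opposite_le (i : Fin n) (j : Fin (m * n)) (s : Bool) (q : Fin 5) :
    (redTree n m).dist (.lit i s q) (.stab i j s) ≤ q + 6 := by
  have h₁ := connected.dist_triangle (u := (.lit i s q : TVert n m)) (v := hub i !s)
    (w := .stab i j s)
  have h₂ := connected.dist_triangle (u := (hub i (!s) : TVert n m)) (v := hub i s)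
    (w := .stab i j s)
  have h₃ := dist_lit_hub_le (m := m) i s q
  have h₄ := dist_hub_hub_le (m := m) i (!s) s
  have h₅ := dist_stab_hub_le i j s
  rw [SimpleGraph.dist_comm] at h₅
  omega

/-- The position of a vertex along the spine of the variable gadget `i`. -/
def spineLevel (i : Fin n) : TVert n m → ℕ
  | .lit i' s _ => if i' = i then (if s then 0 else 6) else 3
  | .varp i' j _ => if i' = i then j + 1 else 3
  | .stab i' _ s => if i' = i then (if s then 6 else 0) else 3
  | _ => 3

lemma spineLevel_lipschitz (i : Fin n) (a b : TVert n m) (h : TAdj n m a b) :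
    spineLevel i a ≤ spineLevel i b + 1 ∧ spineLevel i b ≤ spineLevel i a + 1 := by
  cases h <;> simp only [spineLevel] <;> (try split_ifs) <;> simp <;> omega

lemma le_dist_stab_stab_not (i : Fin n) (j : Fin (m * n)) (s : Bool) :
    6 ≤ (redTree n m).dist (.stab i j s) (.stab i j !s) := by
  have h₁ := le_add_dist (spineLevel_lipschitz (m := m) i) (.stab i j s) (.stab i j !s)
  have h₂ := le_add_dist (spineLevel_lipschitz (m := m) i) (.stab i j !s) (.stab i j s)
  rw [SimpleGraph.dist_comm] at h₂
  cases s <;> simp_all [spineLevel]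

/-- A level function which increases from the ends of the literal paths, through the
central chain vertex, to the clause gadgets. -/
def depthLevel : TVert n m → ℕ
  | .lit _ _ q => 4 - q
  | .varp _ j _ => 7 - ((j - 2 : ℕ) + (2 - j : ℕ))
  | .stab _ _ _ => 5
  | .cl _ q => 12 + ((q - 8 : ℕ) + (8 - q : ℕ))
  | .occ _ _ _ => 19
  | .chain none => 8
  | .chain (some (_, r)) => 9 + r
  | .ext none _ => 8
  | .ext (some (_, r)) _ => 9 + r

lemma depthLevel_lipschitz (a b : TVert n m) (h : TAdj n m a b) :
    depthLevel a ≤ depthLevel b + 1 ∧ depthLevel b ≤ depthLevel a + 1 := by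
  cases h with
  | extAttach c => cases c <;> simp [depthLevel]
  | extPath c => cases c <;> simp [depthLevel]
  | _ => simp [depthLevel] <;> omega

lemma le_dist_lit_occ (i : Fin n) (s : Bool) (q : Fin 5) (j : Fin m) (t : Bool) (r : Fin 2) :
    15 + q ≤ (redTree n m).dist (.lit i s q) (.occ j t r) := by
  have h := le_add_dist depthLevel_lipschitz (.occ j t r : TVert n m) (.lit i s q)
  rw [SimpleGraph.dist_comm] at h
  simp only [depthLevel] at h
  omega

lemma le_dist_lit_zero_lit (i : Fin n) (s t : Bool) (q : Fin 5) :
    q ≤ (redTree n m).dist (.lit i s 0) (.lit i t q) := by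
  have h := le_add_dist (depthLevel_lipschitz (m := m)) (.lit i s 0) (.lit i t q)
  simp only [depthLevel, Fin.val_zero] at h
  omega

/-- A vertex outside a literal path reaches the path through its first vertex. -/
lemma add_dist_le_dist_lit (i : Fin n) (s : Bool) (v : TVert n m)
    (hv : ∀ q, v ≠ .lit i s q) (r : Fin 5) :
    r + (redTree n m).dist v (.lit i s 0) ≤ (redTree n m).dist v (.lit i s r) := by
  let f : TVert n m → ℕ
    | .lit i' s' q => if i' = i ∧ s' = s then q + (redTree n m).dist v (.lit i s 0)
        else (redTree n m).dist v (.lit i' s' q)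
    | x => (redTree n m).dist v x
  have hf : ∀ a b, TAdj n m a b → f a ≤ f b + 1 ∧ f b ≤ f a + 1 := by
    intro a b h
    have key := (adj_of_tAdj h).diff_dist_adj (u := v)
    cases h with
    | litPath i' s' a b hab =>
      by_cases hi : i' = i ∧ s' = s
      · simp only [f, if_pos hi]
        omega
      · simp only [f, if_neg hi]
        omega
    | litPos i' =>
      by_cases hi : i' = i ∧ true = s
      · obtain ⟨rfl, rfl⟩ := hi
        simp only [f, and_self, if_true, Fin.val_zero]
        omega
      · simp only [f, if_neg hi]
        omega
    | litNeg i' =>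
      by_cases hi : i' = i ∧ false = s
      · obtain ⟨rfl, rfl⟩ := hi
        simp only [f, and_self, if_true, Fin.val_zero]
        omega
      · simp only [f, if_neg hi]
        omega
    | _ =>
      simp only [f]
      omega
  have hfv : f v = 0 := by
    rcases v with ⟨i', s', q⟩ | _ | _ | _ | _ | _ | _
    · have hi : ¬(i' = i ∧ s' = s) := by
        rintro ⟨rfl, rfl⟩
        exact hv q rfl
      simp only [f, if_neg hi, SimpleGraph.dist_self]
    all_goals simp only [f, SimpleGraph.dist_self]
  have h := le_add_dist hf (.lit i s r) v
  rw [SimpleGraph.dist_comm, hfv] at h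
  simpa [f] using h

lemma eq_lit_or_occ_of_tcol_eq {θ : Fin m → Lit n × Lit n} {i : Fin n} {s : Bool} {u : TVert n m}
    (h : tcol θ u = .litC i s) : (∃ q, u = .lit i s q) ∨ ∃ j t r, u = .occ j t r := by
  rcases u with ⟨i', s', q⟩ | _ | _ | _ | ⟨j, t, r⟩ | _ | _ <;> simp_all [tcol]

lemma eq_stab_of_tcol_eq {θ : Fin m → Lit n × Lit n} {i : Fin n} {j : Fin (m * n)}
    {u : TVert n m} (h : tcol θ u = .stabC i j) : ∃ s, u = .stab i j s := by
  rcases u with _ | _ | ⟨i', j', s'⟩ | _ | ⟨_, t, _⟩ | _ | _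
  case occ => cases t <;> simp [tcol] at h
  all_goals simp_all [tcol]

/-- Only the vertex of `M` closest to the start of a literal path is needed. -/
lemma isConsistent_diff_lit {θ : Fin m → Lit n × Lit n} {M : Set (TVert n m)}
    (hM : IsConsistent (redTree n m) (tcol θ) M) {i : Fin n} {s : Bool} {q₀ : Fin 5}
    (hq₀ : .lit i s q₀ ∈ M) (hmin : ∀ q, .lit i s q ∈ M → q₀ ≤ q) :
    IsConsistent (redTree n m) (tcol θ) (M \ {v | ∃ r, q₀ < r ∧ v = .lit i s r}) := by
  have hmem : .lit i s q₀ ∈ M \ {v | ∃ r, q₀ < r ∧ v = .lit i s r} := by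
    refine ⟨hq₀, ?_⟩
    rintro ⟨r, hr, heq⟩
    cases heq
    exact hr.false
  have houtside (w : TVert n m) (hw : w ∈ M) : q₀ ≤ (redTree n m).dist (.lit i s 0) w := by
    by_cases h0 : .lit i s 0 ∈ M
    · have : (q₀ : ℕ) ≤ (0 : Fin 5) := hmin 0 h0
      simp only [Fin.val_zero] at this
      omega
    · obtain ⟨u, hu, hcol, hdist⟩ := hM _ h0
      refine le_trans ?_ (hdist w hw)
      rcases eq_lit_or_occ_of_tcol_eq hcol with ⟨q, rfl⟩ | ⟨j, t, r, rfl⟩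
      · have : (q₀ : ℕ) ≤ q := hmin q hu
        exact this.trans (le_dist_lit_zero_lit i s s q)
      · have := le_dist_lit_occ i s 0 j t r
        omega
  intro v hv
  by_cases hpath : ∃ r, v = .lit i s r
  · obtain ⟨r, rfl⟩ := hpath
    refine ⟨_, hmem, rfl, fun w hw => ?_⟩
    by_cases hwpath : ∃ r', w = .lit i s r'
    · obtain ⟨r', rfl⟩ := hwpath
      obtain rfl : r' = q₀ :=
        le_antisymm (not_lt.mp fun h => hw.2 ⟨r', h, rfl⟩) (hmin r' hw.1)
      exact le_rfl
    · have h₁ := add_dist_le_dist_lit i s w (fun q h => hwpath ⟨q, h⟩) r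
      have h₂ := houtside w hw.1
      have h₃ := dist_lit_lit_le (m := m) i s r q₀
      rw [SimpleGraph.dist_comm, SimpleGraph.dist_comm (u := w)] at h₁
      omega
  · have hvpath : ∀ q, v ≠ .lit i s q := fun q h => hpath ⟨q, h⟩
    have hvM : v ∉ M := fun h => hv ⟨h, fun ⟨r, _, h⟩ => hpath ⟨r, h⟩⟩
    obtain ⟨u, hu, hcol, hdist⟩ := hM v hvM
    by_cases hu' : ∃ r, q₀ < r ∧ u = .lit i s r
    · obtain ⟨r, hr, rfl⟩ := hu'
      refine ⟨_, hmem, hcol, fun w hw => le_trans ?_ (hdist w hw.1)⟩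
      have h₁ := add_dist_le_dist_lit i s v hvpath r
      have h₂ := connected.dist_triangle (u := v) (v := .lit i s 0) (w := .lit i s q₀)
      have h₃ := dist_lit_lit_le (m := m) i s 0 q₀
      have h₄ : (q₀ : ℕ) < r := hr
      simp only [Fin.val_zero] at h₃
      omega
    · exact ⟨u, ⟨hu, hu'⟩, hcol, fun w hw => hdist w hw.1⟩

lemma existsUnique_lit_mem {θ : Fin m → Lit n × Lit n} {M : Set (TVert n m)}
    (hM : IsMinConsistent (redTree n m) (tcol θ) M) {i : Fin n} {s : Bool}
    (h : ∃ q, .lit i s q ∈ M) : ∃! q : Fin 5, .lit i s q ∈ M := by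
  obtain ⟨q₀, hq₀, hmin⟩ := WellFounded.has_min (wellFounded_lt (α := Fin 5))
    {q : Fin 5 | TVert.lit i s q ∈ M} h
  have hmin' : ∀ q, .lit i s q ∈ M → q₀ ≤ q := fun q hq => not_lt.mp (hmin q hq)
  have heq := hM.eq_of_subset (isConsistent_diff_lit hM.1 hq₀ hmin') Set.sdiff_subset
  refine ⟨q₀, hq₀, fun q hq => ?_⟩
  have hq : TVert.lit i s q ∈ M := hq
  rw [← heq] at hq
  exact le_antisymm (not_lt.mp fun h => hq.2 ⟨q, h, rfl⟩) (hmin' q hq.1)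

/-- If a gadget misses a stabilizer of side `s`, the literal path far from that side is entered
near its start and the one close to that side at its end. -/
lemma lit_mem_of_stab_not_mem {θ : Fin m → Lit n × Lit n} {M : Set (TVert n m)}
    (hM : IsConsistent (redTree n m) (tcol θ) M) {i : Fin n} {j : Fin (m * n)} {s : Bool}
    (h : .stab i j s ∉ M) :
    (∃ q : Fin 5, (q : ℕ) ≤ 2 ∧ .lit i s q ∈ M) ∧ .lit i (!s) 4 ∈ M := by
  obtain ⟨u, hu, hcol, hdist⟩ := hM _ h
  obtain ⟨t, rfl⟩ := eq_stab_of_tcol_eq hcol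
  obtain rfl : t = !s := by
    cases s <;> cases t <;> simp_all
  have hfar (w : TVert n m) (hw : w ∈ M) : 6 ≤ (redTree n m).dist (.stab i j s) w :=
    (le_dist_stab_stab_not i j s).trans (hdist w hw)
  constructor
  · by_cases h0 : .lit i s 0 ∈ M
    · exact ⟨0, by simp, h0⟩
    · obtain ⟨u, hu', hcol, hdist⟩ := hM _ h0
      have h₁ := (hdist _ hu).trans (dist_lit_stab_le i j s 0)
      simp only [Fin.val_zero] at h₁
      rcases eq_lit_or_occ_of_tcol_eq hcol with ⟨q, rfl⟩ | ⟨j, t, r, rfl⟩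
      · have h₂ := le_dist_lit_zero_lit (m := m) i s s q
        exact ⟨q, by omega, hu'⟩
      · have h₂ := le_dist_lit_occ i s 0 j t r
        omega
  · by_contra h4
    obtain ⟨u, hu', hcol, hdist⟩ := hM _ h4
    rcases eq_lit_or_occ_of_tcol_eq hcol with ⟨q, rfl⟩ | ⟨j', t, r, rfl⟩
    · have h₁ := hfar _ hu'
      have h₂ := dist_lit_stab_le i j (!s) q
      rw [SimpleGraph.dist_comm, Bool.not_not] at h₂
      obtain rfl : q = 4 := Fin.ext (by omega)
      exact h4 hu'
    · have h₁ := (hdist _ hu).trans (dist_lit_stab_opposite_le i j (!s) 4)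
      have h₂ := le_dist_lit_occ i (!s) 4 j' t r
      omega

/-- The distance of a vertex to the consistent subset `smallSet`. -/
def height : TVert n m → ℕ
  | .lit _ s q => if s then q else 4 - q
  | .varp _ j q => (q - (j + 1) : ℕ) + ((j + 1) - q : ℕ)
  | .stab _ _ s => if s then 6 else 0
  | .cl _ q => 3 - ((q - 8 : ℕ) + (8 - q : ℕ))
  | .occ _ _ _ => 0
  | .chain _ => 3
  | .ext _ q => (q - 2 : ℕ) + (2 - q : ℕ)

lemma height_lipschitz (a b : TVert n m) (h : TAdj n m a b) :
    height a ≤ height b + 1 ∧ height b ≤ height a + 1 := by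
  cases h <;> simp only [height] <;> grind

/-- A consistent subset whose size exceeds the number of colours only by a multiple of `m`. -/
def smallSet (n m : ℕ) : Set (TVert n m) := {v | height v = 0}

lemma exists_mem_smallSet_dist_le (θ : Fin m → Lit n × Lit n) (v : TVert n m) :
    ∃ u ∈ smallSet n m, tcol θ u = tcol θ v ∧ (redTree n m).dist v u ≤ height v := by
  rcases v with ⟨i, s, q⟩ | ⟨i, j, q⟩ | ⟨i, j, s⟩ | ⟨j, q⟩ | ⟨j, s, q⟩ | c | ⟨c, q⟩
  · refine ⟨.lit i s (if s then 0 else 4), ?_, rfl, (dist_lit_lit_le i s q _).trans ?_⟩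
    · cases s <;> simp [smallSet, height]
    · cases s <;> simp [height]
      omega
  · refine ⟨.varp i j j.succ, ?_, rfl, ((redTree n m).dist_le_of_consecutive_adj
      (fun q => TVert.varp i j q) (fun a b h => adj_of_tAdj (.varPath i j a b h)) q _).trans ?_⟩
    · simp [smallSet, height]
    · simp [height]
  · refine ⟨.stab i j false, rfl, rfl, ?_⟩
    cases s
    · simp [height]
    · exact dist_stab_stab_le i j j true false
  · have hpath := (redTree n m).dist_le_of_consecutive_adj
      (fun q => TVert.cl j q) (fun a b h => adj_of_tAdj (.clPath j a b h)) q
    by_cases hq : (q : ℕ) ≤ 5 ∨ 11 ≤ (q : ℕ)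
    · refine ⟨.cl j q, ?_, rfl, by simp⟩
      simp only [smallSet, height, Set.mem_ofPred_eq]
      omega
    by_cases hq8 : (q : ℕ) ≤ 8
    · refine ⟨.cl j 5, rfl, rfl, (hpath 5).trans ?_⟩
      simp only [height]
      omega
    · refine ⟨.cl j 11, rfl, rfl, (hpath 11).trans ?_⟩
      simp only [height]
      omega
  · exact ⟨.occ j s q, rfl, rfl, by simp⟩
  · refine ⟨.ext c 2, rfl, rfl, ?_⟩
    have h₁ := (redTree n m).dist_le_of_consecutive_adj
      (fun q => TVert.ext c q) (fun a b h => adj_of_tAdj (.extPath c a b h)) 0 2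
    have h₂ := connected.dist_triangle (u := (.chain c : TVert n m)) (v := .ext c 0)
      (w := .ext c 2)
    have h₃ := (SimpleGraph.dist_eq_one_iff_adj.mpr
      (adj_of_tAdj (.extAttach (n := n) (m := m) c))).le
    simp only [Fin.val_zero] at h₁
    simp only [height]
    omega
  · exact ⟨.ext c 2, rfl, rfl, (redTree n m).dist_le_of_consecutive_adj
      (fun q => TVert.ext c q) (fun a b h => adj_of_tAdj (.extPath c a b h)) q 2⟩

lemma isConsistent_smallSet (θ : Fin m → Lit n × Lit n) :
    IsConsistent (redTree n m) (tcol θ) (smallSet n m) := by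
  intro v _
  obtain ⟨u, hu, hcol, hdist⟩ := exists_mem_smallSet_dist_le θ v
  refine ⟨u, hu, hcol, fun w hw => hdist.trans ?_⟩
  have h := le_add_dist height_lipschitz v w
  rwa [show height w = 0 from hw, zero_add] at h

/-- A vertex of each colour; for a stabilizer pair it is the left one. -/
def colorRep : TCol n m → TVert n m
  | .litC i s => .lit i s (if s then 0 else 4)
  | .varC i j => .varp i j j.succ
  | .stabC i j => .stab i j false
  | .clC j => .cl j 0
  | .chC c => .ext c 2

lemma tcol_colorRep (θ : Fin m → Lit n × Lit n) (c : TCol n m) : tcol θ (colorRep c) = c := by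
  cases c <;> rfl

instance : Finite (TCol n m) := by
  refine Finite.of_injective (colorRep (n := n) (m := m)) fun c d h => ?_
  cases c <;> cases d <;> simp_all [colorRep]

lemma ncard_smallSet_le :
    (smallSet n m).ncard ≤ Nat.card (TCol n m) + 21 * m := by
  let g : TCol n m ⊕ (Fin m × (Fin 17 ⊕ Bool × Fin 2)) → TVert n m :=
    Sum.elim colorRep fun x => x.2.elim (.cl x.1) fun y => .occ x.1 y.1 y.2
  have hsub : smallSet n m ⊆ Set.range g := by
    intro v hv
    simp only [smallSet, Set.mem_ofPred_eq] at hv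
    rcases v with ⟨i, s, q⟩ | ⟨i, j, q⟩ | ⟨i, j, s⟩ | ⟨j, q⟩ | ⟨j, s, q⟩ | c | ⟨c, q⟩
    · refine ⟨.inl (.litC i s), ?_⟩
      cases s <;> simp [g, colorRep, height] at hv ⊢ <;> omega
    · refine ⟨.inl (.varC i j), ?_⟩
      simp [g, colorRep, height] at hv ⊢
      exact Fin.ext (by simp; omega)
    · refine ⟨.inl (.stabC i j), ?_⟩
      cases s <;> simp [g, colorRep, height] at hv ⊢
    · exact ⟨.inr (j, .inl q), rfl⟩
    · exact ⟨.inr (j, .inr (s, q)), rfl⟩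
    · simp [height] at hv
    · refine ⟨.inl (.chC c), ?_⟩
      simp [g, colorRep, height] at hv ⊢
      omega
  calc (smallSet n m).ncard ≤ (Set.range g).ncard := Set.ncard_le_ncard hsub
    _ = Nat.card (Set.range g) := rfl
    _ ≤ Nat.card (TCol n m ⊕ (Fin m × (Fin 17 ⊕ Bool × Fin 2))) := Finite.card_range_le g
    _ = Nat.card (TCol n m) + 21 * m := by
      simp [Nat.card_sum, mul_comm]

lemma le_ncard_of_stab_mem {θ : Fin m → Lit n × Lit n} {M : Set (TVert n m)}
    (hM : IsConsistent (redTree n m) (tcol θ) M) {i : Fin n}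
    (h : ∀ j s, .stab i j s ∈ M) : Nat.card (TCol n m) + m * n ≤ M.ncard := by
  have hrep (c : TCol n m) :
      ∃ u ∈ M, tcol θ u = c ∧ ∀ j : Fin (m * n), u ≠ .stab i j true := by
    by_cases hc : ∃ j, c = .stabC i j
    · obtain ⟨j, rfl⟩ := hc
      exact ⟨.stab i j false, h j false, rfl, by simp⟩
    · obtain ⟨u, hu, hcol⟩ := hM.exists_mem_color_eq (colorRep c)
      rw [tcol_colorRep] at hcol
      refine ⟨u, hu, hcol, ?_⟩
      rintro j rfl
      exact hc ⟨j, hcol.symm⟩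
  choose rep hrepM hrepcol hrepne using hrep
  let g : TCol n m ⊕ Fin (m * n) → M :=
    Sum.elim (fun c => ⟨rep c, hrepM c⟩) fun j => ⟨.stab i j true, h j true⟩
  have hg : Function.Injective g := by
    rintro (c | j) (d | k) hcd <;> simp only [g, Sum.elim_inl, Sum.elim_inr, Subtype.mk.injEq] at hcd
    · rw [← hrepcol c, hcd, hrepcol d]
    · exact (hrepne c k hcd).elim
    · exact (hrepne d j hcd.symm).elim
    · simpa using hcd
  have := Nat.card_le_card_of_injective g hg
  simpa [Nat.card_sum, Nat.card_coe_set_eq] using this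

lemma exists_stab_not_mem (hn : 21 < n) (hm : 0 < m) {θ : Fin m → Lit n × Lit n}
    {M : Set (TVert n m)} (hM : IsMinConsistent (redTree n m) (tcol θ) M) (i : Fin n) :
    ∃ j s, .stab i j s ∉ M := by
  by_contra! h
  have h₁ := le_ncard_of_stab_mem hM.1 h
  have h₂ := hM.2 _ (isConsistent_smallSet θ)
  have h₃ := ncard_smallSet_le (n := n) (m := m)
  have h₄ : m * 21 < m * n := Nat.mul_lt_mul_of_pos_left hn hm
  omega

end RedTree

/-- Every minimum consistent subset `M` of the reduction tree contains exactly one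
vertex from every literal path; moreover, in each variable gadget one of the two
literal paths has one of its first three vertices in `M` while the other literal
path has its fifth vertex in `M`. -/
theorem literal_paths_in_minimum_consistent_subset
    (n m : ℕ) (hn : 50 ≤ n) (hm : 50 ≤ m)
    (θ : Fin m → Lit n × Lit n)
    (M : Set (TVert n m)) (hM : IsMinConsistent (redTree n m) (tcol θ) M) :
    (∀ (i : Fin n) (s : Bool), ∃! q : Fin 5, TVert.lit i s q ∈ M) ∧
    (∀ i : Fin n, ∃ s : Bool,
        (∃ q : Fin 5, (q : ℕ) ≤ 2 ∧ TVert.lit i s q ∈ M) ∧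
        TVert.lit i (!s) 4 ∈ M) := by
  have hgadget (i : Fin n) : ∃ s : Bool,
      (∃ q : Fin 5, (q : ℕ) ≤ 2 ∧ TVert.lit i s q ∈ M) ∧ TVert.lit i (!s) 4 ∈ M := by
    obtain ⟨j, s, h⟩ := RedTree.exists_stab_not_mem (by omega) (by omega) hM i
    exact ⟨s, RedTree.lit_mem_of_stab_not_mem hM.1 h⟩
  refine ⟨fun i s => RedTree.existsUnique_lit_mem hM ?_, hgadget⟩
  obtain ⟨t, ⟨q, -, hq⟩, h4⟩ := hgadget i
  rcases Bool.eq_or_eq_not s t with rfl | rfl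
  · exact ⟨q, hq⟩
  · exact ⟨4, h4⟩
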